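/- Let X be a real Banach space admitting a C¹ Lipschitz bump function and let H₁, H₂ : X × ℝ → ℝ be continuous Hamiltonians each satisfying condition (A). Suppose u : X → ℝ is a bounded viscosity subsolution of u(x) + H₁(x, ‖du(x)‖) = 0, v : X → ℝ is a bounded viscosity supersolution of v(x) + H₂(x, ‖dv(x)‖) = 0, and for every x ∈ X at least one of u, v is Lipschitz on some neighborhood of x. Then sup_X (u − v) ≤ sup_{X × ℝ} (H₂ − H₁). -/

import Mathlib

open Filter Topology

variable {X : Type*} [NormedAddCommGroup X] [NormedSpace ℝ X]

/-- `X` admits a `C¹` Lipschitz bump function. -/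
def HasC1LipBump (X : Type*) [NormedAddCommGroup X] [NormedSpace ℝ X] : Prop :=
  ∃ b : X → ℝ, ContDiff ℝ 1 b ∧ (∃ K : NNReal, LipschitzWith K b) ∧
    Bornology.IsBounded (Function.support b) ∧ (Function.support b).Nonempty

/-- The Fréchet subdifferential of a real-valued function `f` at `x`. -/
def subdiff (f : X → ℝ) (x : X) : Set (X →L[ℝ] ℝ) :=
  {Δ | ∀ ε > (0:ℝ), ∃ δ > (0:ℝ), ∀ h : X, ‖h‖ < δ →
    f x + Δ h - ε * ‖h‖ ≤ f (x + h)}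

/-- The Fréchet superdifferential of a real-valued function `f` at `x`. -/
def superdiff (f : X → ℝ) (x : X) : Set (X →L[ℝ] ℝ) :=
  {Δ | ∀ ε > (0:ℝ), ∃ δ > (0:ℝ), ∀ h : X, ‖h‖ < δ →
    f (x + h) ≤ f x + Δ h + ε * ‖h‖}

/-- Condition (A) for a Hamiltonian `H : X × ℝ → ℝ`. -/
def CondA (H : X → ℝ → ℝ) : Prop :=
  ∃ (C : ℝ) (ω : ℝ → ℝ → ℝ), 0 ≤ C ∧
    Continuous (fun p : ℝ × ℝ => ω p.1 p.2) ∧ ω 0 0 = 0 ∧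
    ∀ (x₁ x₂ : X) (t₁ t₂ : ℝ),
      |H x₁ t₁ - H x₂ t₂| ≤ ω ‖x₁ - x₂‖ (t₁ - t₂) + C * max |t₁| |t₂| * ‖x₁ - x₂‖

/-- A differentiable bump function normalised to take values in `[0, 1]`, to be positive at the
origin, to vanish outside the open unit ball, and to have a bounded derivative. -/
def HasUnitBump (Z : Type*) [NormedAddCommGroup Z] [NormedSpace ℝ Z] : Prop :=
  ∃ (b : Z → ℝ) (b' : Z → Z →L[ℝ] ℝ) (L : ℝ), (∀ z, HasFDerivAt b (b' z) z) ∧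
    (∀ z, ‖b' z‖ ≤ L) ∧ (∀ z, 0 ≤ b z) ∧ (∀ z, b z ≤ 1) ∧ 0 < b 0 ∧ ∀ z, 1 ≤ ‖z‖ → b z = 0

theorem HasC1LipBump.hasUnitBump (h : HasC1LipBump X) : HasUnitBump X := by
  obtain ⟨b, hb, ⟨K, hK⟩, hbd, ⟨x₁, hx₁⟩⟩ := h
  obtain ⟨R, hR0, hR⟩ := hbd.subset_closedBall_lt 0 x₁
  set S : ℝ := R + 1 with hS
  have hS0 : 0 < S := by linarith
  have hθ : ∀ s : ℝ, HasDerivAt (fun s : ℝ => s ^ 2 / (1 + s ^ 2)) (2 * s / (1 + s ^ 2) ^ 2) s := by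
    intro s
    have h1 : HasDerivAt (fun s : ℝ => s ^ 2) (2 * s) s := by
      simpa using hasDerivAt_pow 2 s
    have h2 : (1 + s ^ 2 : ℝ) ≠ 0 := by positivity
    refine (h1.div (h1.const_add 1) h2).congr_deriv ?_
    congr 1
    ring
  have hθ' : ∀ s : ℝ, |2 * s / (1 + s ^ 2) ^ 2| ≤ 1 := by
    intro s
    rw [abs_div, abs_of_pos (show (0 : ℝ) < (1 + s ^ 2) ^ 2 by positivity),
      div_le_one (by positivity), abs_le]
    constructor <;> nlinarith [sq_nonneg (s - 1), sq_nonneg (s + 1), sq_nonneg (s ^ 2), sq_nonneg s]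
  have hi : ∀ z : X, HasFDerivAt (fun z : X => b (x₁ + S • z))
      ((fderiv ℝ b (x₁ + S • z)).comp (S • ContinuousLinearMap.id ℝ X)) z := by
    intro z
    have h1 : HasFDerivAt (fun z : X => x₁ + S • z) (S • ContinuousLinearMap.id ℝ X) z :=
      ((hasFDerivAt_id z).const_smul S).const_add x₁
    have h2 := (hb.differentiable (by norm_num) (x₁ + S • z)).hasFDerivAt
    exact HasFDerivAt.comp (g := b) z h2 h1
  refine ⟨fun z => b (x₁ + S • z) ^ 2 / (1 + b (x₁ + S • z) ^ 2), _, K * S,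
    fun z => (hθ _).comp_hasFDerivAt z (hi z), ?_, ?_, ?_, ?_, ?_⟩
  · intro z
    rw [norm_smul, Real.norm_eq_abs]
    have h1 : ‖(fderiv ℝ b (x₁ + S • z)).comp (S • ContinuousLinearMap.id ℝ X)‖ ≤ K * S := by
      refine (ContinuousLinearMap.opNorm_comp_le _ _).trans ?_
      refine mul_le_mul (norm_fderiv_le_of_lipschitz ℝ hK) ?_ (norm_nonneg _) K.2
      rw [norm_smul, Real.norm_eq_abs, abs_of_pos hS0]
      exact mul_le_of_le_one_right hS0.le ContinuousLinearMap.norm_id_le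
    calc _ ≤ 1 * (K * S) := mul_le_mul (hθ' _) h1 (norm_nonneg _) zero_le_one
      _ = _ := one_mul _
  · intro z; positivity
  · intro z
    rw [div_le_one (by positivity)]
    linarith
  · have : b x₁ ≠ 0 := hx₁
    simp only [smul_zero, add_zero]
    positivity
  · intro z hz
    have : b (x₁ + S • z) = 0 := by
      by_contra hne
      have h1 := hR (show x₁ + S • z ∈ Function.support b from hne)
      rw [mem_closedBall_iff_norm, add_sub_cancel_left, norm_smul, Real.norm_eq_abs,
        abs_of_pos hS0] at h1
      nlinarith
    simp [this]

theorem HasUnitBump.prod (h : HasUnitBump X) : HasUnitBump (X × X) := by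
  obtain ⟨b, b', L, hd, hL, h0, h1, hp, hz⟩ := h
  have hf : ∀ z : X × X, HasFDerivAt (fun z : X × X => b z.1)
      ((b' z.1).comp (ContinuousLinearMap.fst ℝ X X)) z := fun z =>
    HasFDerivAt.comp (g := b) z (hd z.1) hasFDerivAt_fst
  have hs : ∀ z : X × X, HasFDerivAt (fun z : X × X => b z.2)
      ((b' z.2).comp (ContinuousLinearMap.snd ℝ X X)) z := fun z =>
    HasFDerivAt.comp (g := b) z (hd z.2) hasFDerivAt_snd
  have hbound : ∀ (c : ℝ) (A : X →L[ℝ] ℝ) (B : X × X →L[ℝ] X), 0 ≤ c → c ≤ 1 → ‖A‖ ≤ L →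
      ‖B‖ ≤ 1 → ‖c • A.comp B‖ ≤ L := by
    intro c A B hc hc1 hA hB
    rw [norm_smul, Real.norm_eq_abs, abs_of_nonneg hc]
    have hAB : ‖A.comp B‖ ≤ L * 1 := (A.opNorm_comp_le B).trans
      (mul_le_mul hA hB (norm_nonneg _) ((norm_nonneg _).trans hA))
    nlinarith [norm_nonneg (A.comp B)]
  refine ⟨fun z => b z.1 * b z.2, _, 2 * L, fun z => (hf z).mul (hs z), ?_, ?_, ?_, ?_, ?_⟩
  · intro z
    refine (norm_add_le _ _).trans ?_
    have e1 := hbound (b z.1) (b' z.2) _ (h0 _) (h1 _) (hL _)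
      (ContinuousLinearMap.norm_snd_le ℝ X X)
    have e2 := hbound (b z.2) (b' z.1) _ (h0 _) (h1 _) (hL _)
      (ContinuousLinearMap.norm_fst_le ℝ X X)
    linarith
  · exact fun z => mul_nonneg (h0 _) (h0 _)
  · exact fun z => mul_le_one₀ (h1 _) (h0 _) (h1 _)
  · exact mul_pos hp hp
  · intro z h
    rcases le_max_iff.1 (h.trans_eq (Prod.norm_def z)) with h | h
    · simp [hz _ h]
    · simp [hz _ h]

/-- Successive almost minimisation: each point of the sequence almost minimises `f` corrected by
the terms attached to the previous points. -/
theorem exists_seq_almost_minimizers {Z : Type*} (f : Z → ℝ) (S : Set Z) (hS : S.Nonempty)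
    (m : ℝ) (hm : ∀ z ∈ S, m ≤ f z) (T : ℕ → Z → Z → ℝ) (A : ℕ → ℝ)
    (hT : ∀ i c z, T i c z ≤ A i) (e : ℕ → ℝ) (he : ∀ n, 0 < e n) :
    ∃ x : ℕ → Z, ∀ n, x n ∈ S ∧ ∀ z ∈ S,
      f (x n) - ∑ i ∈ Finset.range n, T i (x i) (x n) ≤
        f z - ∑ i ∈ Finset.range n, T i (x i) z + e n := by
  have key : ∀ (n : ℕ) (p : Z → ℝ), ∃ c ∈ S, (∃ m, ∀ z ∈ S, m ≤ f z - p z) →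
      ∀ z ∈ S, f c - p c ≤ f z - p z + e n := by
    intro n p
    by_cases hb : ∃ m, ∀ z ∈ S, m ≤ f z - p z
    · obtain ⟨m, hm⟩ := hb
      have hne : ((fun z => f z - p z) '' S).Nonempty := hS.image _
      have hbd : BddBelow ((fun z => f z - p z) '' S) := by
        refine ⟨m, ?_⟩
        rintro _ ⟨z, hz, rfl⟩
        exact hm z hz
      obtain ⟨_, ⟨c, hc, rfl⟩, hlt⟩ := exists_lt_of_csInf_lt hne
        (lt_add_of_pos_right (sInf ((fun z => f z - p z) '' S)) (he n))
      refine ⟨c, hc, fun _ z hz => hlt.le.trans ?_⟩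
      gcongr
      exact csInf_le hbd ⟨z, hz, rfl⟩
    · obtain ⟨c, hc⟩ := hS
      exact ⟨c, hc, fun h => absurd h hb⟩
  choose c hcS hc using key
  let p : ℕ → Z → ℝ := fun n => Nat.rec (fun _ => 0) (fun n p z => p z + T n (c n p) z) n
  have hp : ∀ n z, p n z = ∑ i ∈ Finset.range n, T i (c i (p i)) z := by
    intro n
    induction n with
    | zero => intro z; simp [p]
    | succ n ih => intro z; rw [Finset.sum_range_succ, ← ih]
  refine ⟨fun n => c n (p n), fun n => ⟨hcS _ _, fun z hz => ?_⟩⟩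
  rw [← hp, ← hp]
  refine hc n (p n) ⟨m - ∑ i ∈ Finset.range n, A i, fun w hw => ?_⟩ z hz
  rw [hp]
  exact sub_le_sub (hm w hw) (Finset.sum_le_sum fun i _ => hT _ _ _)

/-- The Deville–Godefroy–Zizler smooth variational principle, on a closed set. -/
theorem HasUnitBump.exists_strong_min {Z : Type*} [NormedAddCommGroup Z] [NormedSpace ℝ Z]
    [CompleteSpace Z] (hb : HasUnitBump Z) (f : Z → ℝ) (hf : LowerSemicontinuous f) (S : Set Z)
    (hSc : IsClosed S) (hS : S.Nonempty) (m : ℝ) (hm : ∀ z ∈ S, m ≤ f z) {ε : ℝ} (hε : 0 < ε) :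
    ∃ (g : Z → ℝ) (g' : Z → Z →L[ℝ] ℝ), ∃ x₀ ∈ S, (∀ z, HasFDerivAt g (g' z) z) ∧
      (∀ z, |g z| ≤ ε) ∧ (∀ z, ‖g' z‖ ≤ ε) ∧ (∀ z ∈ S, f x₀ + g x₀ ≤ f z + g z) ∧
      ∀ r > 0, ∃ η > 0, ∀ z ∈ S, f z + g z ≤ f x₀ + g x₀ + η → ‖z - x₀‖ ≤ r := by
  obtain ⟨b, b', L, hd, hL, h0, h1, hp, hz⟩ := hb
  have hL0 : 0 ≤ L := (norm_nonneg _).trans (hL 0)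
  set β := b 0 with hβ
  have hβ1 : β ≤ 1 := h1 0
  set q := β / 16 with hq
  have hq0 : 0 < q := by positivity
  have hq1 : q ≤ 1 / 16 := by linarith
  set α := ε / (2 * (L + 1)) with hα
  have hα0 : 0 < α := by positivity
  have hαε : 2 * α ≤ ε ∧ 2 * (α * L) ≤ ε := by
    have : α * (2 * (L + 1)) = ε := div_mul_cancel₀ _ (by positivity)
    constructor <;> nlinarith
  set a : ℕ → ℝ := fun n => α * q ^ n with ha
  have ha0 : ∀ n, 0 < a n := fun n => by positivity
  have hasucc : ∀ n, a (n + 1) = q * a n := fun n => by simp only [ha]; ring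
  have haanti : ∀ n k, a (k + n) ≤ a n := by
    intro n k
    induction k with
    | zero => simp
    | succ k ih =>
      rw [show k + 1 + n = (k + n) + 1 by ring, hasucc]
      nlinarith [ha0 (k + n)]
  set l : ℕ → ℝ := fun n => (2 * q) ^ n with hl
  have hl0 : ∀ n, 0 < l n := fun n => by positivity
  set T : ℕ → Z → Z → ℝ := fun i c z => a i * b ((l i)⁻¹ • (z - c)) with hT
  have hT0 : ∀ i c z, 0 ≤ T i c z := fun i c z => mul_nonneg (ha0 i).le (h0 _)
  have hT1 : ∀ i c z, T i c z ≤ a i := fun i c z => mul_le_of_le_one_right (ha0 i).le (h1 _)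
  obtain ⟨x, hx⟩ := exists_seq_almost_minimizers f S hS m hm T a hT1 (fun n => a n * β / 2)
    (fun n => by have := ha0 n; positivity)
  have hasum : ∀ n, HasSum (fun i => a (i + n)) (a n * (1 - q)⁻¹) := by
    intro n
    have := (hasSum_geometric_of_lt_one hq0.le (by linarith : q < 1)).mul_left (a n)
    refine this.congr_fun fun i => ?_
    simp only [ha]
    ring
  have hinv : (1 - q)⁻¹ ≤ 2 := by
    rw [inv_le_comm₀ (by linarith) (by norm_num)]; linarith
  have hTsum : ∀ z, Summable (fun i => T i (x i) z) := fun z =>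
    Summable.of_nonneg_of_le (fun i => hT0 _ _ _) (fun i => hT1 _ _ _)
      (by simpa using (hasum 0).summable)
  set G : Z → ℝ := fun z => ∑' i, T i (x i) z with hG
  have hGl : ∀ n z, ∑ i ∈ Finset.range n, T i (x i) z ≤ G z := fun n z =>
    (hTsum z).sum_le_tsum _ (fun i _ => hT0 _ _ _)
  have hGu : ∀ n z, G z ≤ ∑ i ∈ Finset.range n, T i (x i) z + 2 * a n := by
    intro n z
    have e := (hTsum z).sum_add_tsum_nat_add n
    rw [show G z = _ from e.symm]
    gcongr
    refine (((summable_nat_add_iff n).2 (hTsum z)).tsum_le_tsum (fun i => hT1 _ _ _)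
      (hasum n).summable).trans ?_
    rw [(hasum n).tsum_eq]
    nlinarith [ha0 n]
  have hTd : ∀ i z, HasFDerivAt (T i (x i))
      ((a i * (l i)⁻¹) • b' ((l i)⁻¹ • (z - x i))) z := by
    intro i z
    have e1 : HasFDerivAt (fun z : Z => (l i)⁻¹ • (z - x i))
        ((l i)⁻¹ • ContinuousLinearMap.id ℝ Z) z :=
      ((hasFDerivAt_id z).sub_const (x i)).const_smul _
    have e2 := (HasFDerivAt.comp (g := b) z (hd _) e1).const_mul (a i)
    refine HasFDerivAt.congr_fderiv (f := T i (x i)) e2 ?_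
    ext w
    simp [mul_assoc]
  have hTd' : ∀ i z, ‖(a i * (l i)⁻¹) • b' ((l i)⁻¹ • (z - x i))‖ ≤ (α * L) * (1 / 2) ^ i := by
    intro i z
    have e : a i * (l i)⁻¹ = α * (1 / 2) ^ i := by
      simp only [ha, hl, mul_pow, mul_inv]
      have : q ^ i ≠ 0 := by positivity
      rw [one_div, inv_pow]
      field_simp
    rw [norm_smul, e, Real.norm_eq_abs, abs_of_pos (by positivity)]
    calc _ ≤ α * (1 / 2) ^ i * L := by gcongr; exact hL _
      _ = _ := by ring
  have hhalf : HasSum (fun i : ℕ => (α * L) * (1 / 2 : ℝ) ^ i) (α * L * 2) :=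
    hasSum_geometric_two.mul_left _
  have hGd := hasFDerivAt_tsum (f := fun i => T i (x i)) hhalf.summable hTd hTd' (hTsum 0)
  have hGcont : Continuous G := continuous_iff_continuousAt.2 fun z => (hGd z).continuousAt
  have hstar : ∀ k, ∀ z ∈ S, f (x k) - G (x k) ≤ f z - G z + 3 * a k := by
    intro k z hz
    have e1 := (hx k).2 z hz
    have e2 := hGl k (x k)
    have e3 := hGu k z
    nlinarith [ha0 k]
  have hball : ∀ n, ∀ w ∈ S, f w - G w < f (x n) - G (x n) + a n * β / 4 →
      ‖w - x n‖ < l n := by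
    intro n w hw hlt
    by_contra hge
    rw [not_lt] at hge
    have e1 := (hx n).2 w hw
    have e2 := hGu (n + 1) w
    have e3 := hGl (n + 1) (x n)
    have e4 : T n (x n) w = 0 := by
      have : b ((l n)⁻¹ • (w - x n)) = 0 := by
        apply hz
        rw [norm_smul, norm_inv, Real.norm_eq_abs, abs_of_pos (hl0 n), inv_mul_eq_div,
          one_le_div (hl0 n)]
        exact hge
      simp [hT, this]
    have e5 : T n (x n) (x n) = a n * β := by simp [hT, hβ]
    rw [Finset.sum_range_succ, e4, hasucc] at e2
    rw [Finset.sum_range_succ, e5] at e3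
    have : q * a n = a n * β / 16 := by rw [hq]; ring
    have := mul_pos (ha0 n) hp
    linarith
  have hxx : ∀ n k, n ≤ k → ‖x k - x n‖ ≤ l n := by
    intro n k hnk
    rcases hnk.eq_or_lt with rfl | hlt
    · simpa using (hl0 n).le
    · refine (hball n (x k) (hx k).1 ?_).le
      have e1 := hstar k (x n) (hx n).1
      have e2 : a k ≤ q * a n := by
        rw [← hasucc]
        obtain ⟨j, rfl⟩ := Nat.exists_eq_add_of_lt hlt
        have := haanti (n + 1) j
        rwa [show j + (n + 1) = n + j + 1 by ring] at this
      have : q * a n = a n * β / 16 := by rw [hq]; ring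
      have := mul_pos (ha0 n) hp
      linarith
  have hlt0 : Tendsto l atTop (𝓝 0) :=
    tendsto_pow_atTop_nhds_zero_of_lt_one (by positivity) (by linarith)
  have ha_lim : Tendsto a atTop (𝓝 0) := by
    simpa using (tendsto_pow_atTop_nhds_zero_of_lt_one hq0.le (by linarith : q < 1)).const_mul α
  have hcau : CauchySeq x := by
    refine cauchySeq_of_le_tendsto_0' l (fun n k hnk => ?_) hlt0
    rw [dist_comm, dist_eq_norm]
    exact hxx n k hnk
  obtain ⟨x₀, hx₀⟩ := cauchySeq_tendsto_of_complete hcau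
  have hx₀S : x₀ ∈ S := hSc.mem_of_tendsto hx₀ (Eventually.of_forall fun n => (hx n).1)
  have hlsc : LowerSemicontinuous (fun z => f z + -G z) :=
    hf.add hGcont.neg.lowerSemicontinuous
  have hmin : ∀ z ∈ S, f x₀ - G x₀ ≤ f z - G z := by
    intro z hz
    refine le_of_forall_lt_imp_le_of_dense fun y hy => ?_
    have e1 := hx₀.eventually (hlsc x₀ y (by simpa [sub_eq_add_neg] using hy))
    have e2 : Tendsto (fun k => f z - G z + 3 * a k) atTop (𝓝 (f z - G z)) := by
      simpa using (ha_lim.const_mul 3).const_add (f z - G z)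
    refine ge_of_tendsto e2 (e1.mono fun k hk => ?_)
    have := hstar k z hz
    linarith
  refine ⟨fun z => -G z, _, x₀, hx₀S, fun z => (hGd z).neg, ?_, ?_, ?_, ?_⟩
  · intro z
    rw [abs_neg, abs_of_nonneg (tsum_nonneg fun i => hT0 _ _ _)]
    have := hGu 0 z
    simp [ha] at this
    linarith [hαε.1]
  · intro z
    rw [norm_neg]
    refine (tsum_of_norm_bounded hhalf fun i => hTd' i z).trans ?_
    linarith [hαε.2]
  · intro z hz
    have := hmin z hz
    linarith
  · intro r hr
    obtain ⟨n, hn⟩ := (hlt0.eventually (gt_mem_nhds (half_pos hr))).exists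
    have hpos := mul_pos (ha0 n) hp
    refine ⟨a n * β / 8, by positivity, fun z hz hle => ?_⟩
    have e1 := hball n z hz (by linarith [hmin (x n) (hx n).1])
    have e2 := hball n x₀ hx₀S (by linarith [hmin (x n) (hx n).1])
    have e3 := norm_sub_le (z - x n) (x₀ - x n)
    rw [sub_sub_sub_cancel_right] at e3
    linarith

theorem mem_superdiff_of_eventually_le {u θ : X → ℝ} {x : X} {A : X →L[ℝ] ℝ}
    (hθ : HasFDerivAt θ A x) (h : ∀ᶠ z in 𝓝 x, u z - θ z ≤ u x - θ x) : A ∈ superdiff u x := by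
  intro ε hε
  have h1 := (hasFDerivAt_iff_isLittleO_nhds_zero.1 hθ).def hε
  have h2 : ∀ᶠ k in 𝓝 (0 : X), u (x + k) - θ (x + k) ≤ u x - θ x := by
    have : Tendsto (fun k : X => x + k) (𝓝 0) (𝓝 x) := by
      simpa using (continuous_const_add x).tendsto (0 : X)
    exact this.eventually h
  obtain ⟨δ, hδ, hk⟩ := Metric.eventually_nhds_iff.1 (h1.and h2)
  refine ⟨δ, hδ, fun k hkδ => ?_⟩
  obtain ⟨e1, e2⟩ := hk (by simpa using hkδ)
  have := (abs_le.1 e1).2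
  linarith

theorem neg_mem_superdiff_neg {v : X → ℝ} {x : X} {A : X →L[ℝ] ℝ} :
    -A ∈ superdiff (fun z => -v z) x ↔ A ∈ subdiff v x := by
  constructor <;> intro h ε hε <;> obtain ⟨δ, hδ, hk⟩ := h ε hε <;>
    refine ⟨δ, hδ, fun k hkδ => ?_⟩ <;> have := hk k hkδ <;>
    simp only [neg_apply] at this ⊢ <;> linarith

theorem mem_subdiff_of_eventually_le {v θ : X → ℝ} {x : X} {A : X →L[ℝ] ℝ}
    (hθ : HasFDerivAt θ A x) (h : ∀ᶠ z in 𝓝 x, v x - θ x ≤ v z - θ z) : A ∈ subdiff v x := by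
  refine neg_mem_superdiff_neg.1 (mem_superdiff_of_eventually_le hθ.neg ?_)
  filter_upwards [h] with z hz
  simp only [Pi.neg_apply]
  linarith

theorem norm_le_of_mem_superdiff {u : X → ℝ} {x : X} {A : X →L[ℝ] ℝ} (hA : A ∈ superdiff u x)
    {U : Set X} (hU : U ∈ 𝓝 x) {K : NNReal} (hK : LipschitzOnWith K u U) : ‖A‖ ≤ K + 1 := by
  obtain ⟨δ, hδ, hk⟩ := hA 1 one_pos
  obtain ⟨r, hr, hrU⟩ := Metric.mem_nhds_iff.1 hU
  have hle : ∀ k : X, ‖k‖ < min δ r → -A k ≤ (K + 1) * ‖k‖ := by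
    intro k hkn
    have e1 := hk k (hkn.trans_le (min_le_left _ _))
    have e2 := hK.dist_le_mul (x + k) (hrU (by simpa using hkn.trans_le (min_le_right _ _))) x
      (mem_of_mem_nhds hU)
    rw [Real.dist_eq, dist_eq_norm, add_sub_cancel_left] at e2
    have := (abs_le.1 e2).1
    linarith
  refine ContinuousLinearMap.opNorm_le_of_ball (lt_min hδ hr) (by positivity) fun k hkb => ?_
  have hkn : ‖k‖ < min δ r := by simpa using hkb
  rw [Real.norm_eq_abs, abs_le]
  have e1 := hle k hkn
  have e2 := hle (-k) (by rwa [norm_neg])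
  rw [map_neg, norm_neg] at e2
  constructor <;> linarith

/-- A smooth gauge: a differentiable function with a strong minimum, equal to `0`, at the
origin. -/
theorem HasUnitBump.exists_gauge [CompleteSpace X] (hb : HasUnitBump X) :
    ∃ (φ : X → ℝ) (φ' : X → X →L[ℝ] ℝ), (∀ x, HasFDerivAt φ (φ' x) x) ∧ φ 0 = 0 ∧
      (∀ x, 0 ≤ φ x) ∧ ∀ r > 0, ∃ η > 0, ∀ x, φ x ≤ η → ‖x‖ ≤ r := by
  obtain ⟨g, g', x₀, -, hd, -, -, hmin, hs⟩ := hb.exists_strong_min (fun _ => 0)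
    continuous_const.lowerSemicontinuous Set.univ isClosed_univ ⟨0, trivial⟩ 0
    (fun _ _ => le_rfl) one_pos
  refine ⟨fun x => g (x₀ + x) - g x₀, fun x => g' (x₀ + x), fun x => ?_, by simp, fun x => ?_,
    fun r hr => ?_⟩
  · have := HasFDerivAt.comp (g := g) x (hd (x₀ + x)) ((hasFDerivAt_id x).const_add x₀)
    exact this.sub_const _
  · have := hmin (x₀ + x) trivial
    linarith
  · obtain ⟨η, hη, h⟩ := hs r hr
    refine ⟨η, hη, fun x hx => ?_⟩
    simpa using h (x₀ + x) trivial (by linarith)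

/-- Doubling of variables near a strong minimum of a smooth perturbation of `v - u`. -/
theorem HasUnitBump.exists_superdiff_subdiff [CompleteSpace X] (hb : HasUnitBump X)
    {u v g : X → ℝ} {g' : X → X →L[ℝ] ℝ} (husc : UpperSemicontinuous u)
    (hvlsc : LowerSemicontinuous v) {B : ℝ} (hu : ∀ x, |u x| ≤ B) (hv : ∀ x, |v x| ≤ B)
    (hg : ∀ x, HasFDerivAt g (g' x) x) {ε : ℝ} (hε : 0 < ε) (hgε : ∀ x, |g x| ≤ ε)
    (hg'ε : ∀ x, ‖g' x‖ ≤ ε) {x₀ : X}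
    (hstrong : ∀ r > 0, ∃ η > 0, ∀ z, v z - u z + g z ≤ v x₀ - u x₀ + g x₀ + η → ‖z - x₀‖ ≤ r)
    {U : Set X} (hU : U ∈ 𝓝 x₀) {K : NNReal} (hK : LipschitzOnWith K u U) {δ : ℝ} (hδ : 0 < δ) :
    ∃ (x y : X), ∃ P ∈ superdiff u x, ∃ Q ∈ subdiff v y, ‖P‖ ≤ K + 1 ∧ ‖P - Q‖ ≤ 3 * ε ∧
      ‖x - y‖ ≤ δ ∧ v y - u x ≤ v x₀ - u x₀ + 4 * ε := by
  obtain ⟨φ, φ', hφ, hφ0, hφnn, hφs⟩ := hb.exists_gauge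
  obtain ⟨r, hr, hrU⟩ := Metric.nhds_basis_closedBall.mem_iff.1 hU
  obtain ⟨η, hη, hηs⟩ := hstrong (r / 4) (by positivity)
  set d := min (min δ (r / 4)) (η / (2 * (K + 1))) with hd
  have hd0 : 0 < d := by positivity
  have hdδ : d ≤ δ := (min_le_left _ _).trans (min_le_left _ _)
  have hdr : d ≤ r / 4 := (min_le_left _ _).trans (min_le_right _ _)
  have hdη : K * d ≤ η / 2 := by
    have h1 : d ≤ η / (2 * (K + 1)) := min_le_right _ _
    rw [le_div_iff₀ (by positivity)] at h1
    nlinarith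
  obtain ⟨η₁, hη₁, hη₁s⟩ := hφs d hd0
  set ε' := min ε (η / 4) with hε'
  have hε'0 : 0 < ε' := by positivity
  have hε'ε : ε' ≤ ε := min_le_left _ _
  have hε'η : ε' ≤ η / 4 := min_le_right _ _
  have hB : 0 ≤ B := (abs_nonneg _).trans (hu 0)
  set n := (4 * B + 4 * ε) / η₁ with hn
  have hn0 : 0 < n := by positivity
  have hnη : n * η₁ = 4 * B + 4 * ε := div_mul_cancel₀ _ hη₁.ne'
  set F : X × X → ℝ := fun p => v p.2 + -u p.1 + (g p.2 + n * φ (p.1 - p.2)) with hF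
  have hgc : Continuous g := continuous_iff_continuousAt.2 fun z => (hg z).continuousAt
  have hφc : Continuous φ := continuous_iff_continuousAt.2 fun z => (hφ z).continuousAt
  have hFlsc : LowerSemicontinuous F := by
    have h1 : LowerSemicontinuous (fun p : X × X => v p.2) := hvlsc.comp continuous_snd
    have h2 : LowerSemicontinuous (fun p : X × X => -u p.1) :=
      husc.neg.comp continuous_fst
    have h3 : Continuous (fun p : X × X => g p.2 + n * φ (p.1 - p.2)) := by fun_prop
    exact (h1.add h2).add h3.lowerSemicontinuous
  have hFlow : ∀ p, -(2 * B) - ε + n * φ (p.1 - p.2) ≤ F p := by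
    intro p
    have e1 := abs_le.1 (hu p.1)
    have e2 := abs_le.1 (hv p.2)
    have e3 := abs_le.1 (hgε p.2)
    simp only [hF]
    linarith [e1.2, e2.1, e3.1]
  obtain ⟨ψ, ψ', ⟨x, y⟩, hxyS, hψ, hψε, hψ'ε, hmin, -⟩ := hb.prod.exists_strong_min F hFlsc
    (Metric.closedBall (x₀, x₀) r) Metric.isClosed_closedBall ⟨_, Metric.mem_closedBall_self hr.le⟩
    (-(2 * B) - ε) (fun p _ => by
      have := mul_nonneg hn0.le (hφnn (p.1 - p.2))
      linarith [hFlow p]) hε'0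
  have hF0 : F (x₀, x₀) = v x₀ - u x₀ + g x₀ := by simp [hF, hφ0]; ring
  have hFxy : F (x, y) ≤ v x₀ - u x₀ + g x₀ + 2 * ε' := by
    have e1 := hmin (x₀, x₀) (Metric.mem_closedBall_self hr.le)
    have e2 := (abs_le.1 (hψε (x₀, x₀))).2
    have e3 := (abs_le.1 (hψε (x, y))).1
    linarith
  have hφn : 0 ≤ n * φ (x - y) := mul_nonneg hn0.le (hφnn _)
  have hxy : ‖x - y‖ ≤ d := by
    apply hη₁s
    have e1 := hFlow (x, y)
    have e2 := abs_le.1 (hu x₀)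
    have e3 := abs_le.1 (hv x₀)
    have e4 := abs_le.1 (hgε x₀)
    have : n * φ (x - y) ≤ n * η₁ := by
      rw [hnη]
      simp only at e1
      linarith [e2.1, e3.2, e4.2]
    exact le_of_mul_le_mul_left this hn0
  rw [mem_closedBall_iff_norm, Prod.norm_def, max_le_iff] at hxyS
  have hxU : x ∈ U := hrU (mem_closedBall_iff_norm.2 hxyS.1)
  have hyU : y ∈ U := hrU (mem_closedBall_iff_norm.2 hxyS.2)
  have hFe : F (x, y) = v y - u x + g y + n * φ (x - y) := by simp only [hF]; ring
  have hyx₀ : ‖y - x₀‖ ≤ r / 4 := by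
    apply hηs
    have e1 := hK.dist_le_mul x hxU y hyU
    rw [Real.dist_eq, dist_eq_norm] at e1
    have e2 := (abs_le.1 e1).2
    have e3 : K * ‖x - y‖ ≤ K * d := by gcongr
    linarith
  have hxx₀ : ‖x - x₀‖ ≤ r / 2 := by
    have := norm_add_le (x - y) (y - x₀)
    rw [sub_add_sub_cancel] at this
    linarith
  have hnear : ∀ w : X, ‖w - x₀‖ ≤ r / 2 → ∀ᶠ z in 𝓝 w, z ∈ Metric.closedBall x₀ r := by
    intro w hw
    refine Metric.closedBall_mem_nhds_of_mem ?_
    rw [mem_ball_iff_norm]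
    linarith
  set P : X →L[ℝ] ℝ := n • φ' (x - y) + (ψ' (x, y)).comp (ContinuousLinearMap.inl ℝ X X) with hP
  set Q : X →L[ℝ] ℝ := -(g' y + n • -φ' (x - y) +
    (ψ' (x, y)).comp (ContinuousLinearMap.inr ℝ X X)) with hQ
  have hPmem : P ∈ superdiff u x := by
    have h1 : HasFDerivAt (fun z => n * φ (z - y) + ψ (z, y)) P x := by
      have h2 := HasFDerivAt.comp (g := φ) x (hφ (x - y)) ((hasFDerivAt_id x).sub_const y)
      refine (h2.const_mul n).add ?_
      exact HasFDerivAt.comp (g := ψ) x (hψ (x, y)) (hasFDerivAt_prodMk_left x y)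
    refine mem_superdiff_of_eventually_le h1 ?_
    filter_upwards [hnear x hxx₀] with z hz
    have := hmin (z, y) (by
      rw [← closedBall_prod_same]
      exact ⟨hz, mem_closedBall_iff_norm.2 hxyS.2⟩)
    simp only [hF] at this
    linarith
  have hQmem : Q ∈ subdiff v y := by
    have h1 : HasFDerivAt (fun z => -(g z + n * φ (x - z) + ψ (x, z))) Q y := by
      refine (((hg y).add (HasFDerivAt.const_mul ?_ n)).add ?_).neg
      · have := HasFDerivAt.comp (g := φ) y (hφ (x - y)) ((hasFDerivAt_id y).const_sub x)
        refine this.congr_fderiv ?_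
        ext w
        simp
      · exact HasFDerivAt.comp (g := ψ) y (hψ (x, y)) (hasFDerivAt_prodMk_right x y)
    refine mem_subdiff_of_eventually_le h1 ?_
    filter_upwards [hnear y (by linarith)] with z hz
    have := hmin (x, z) (by
      rw [← closedBall_prod_same]
      exact ⟨mem_closedBall_iff_norm.2 hxyS.1, hz⟩)
    simp only [hF] at this
    linarith
  have hUx : U ∈ 𝓝 x := mem_of_superset (hnear x hxx₀) hrU
  refine ⟨x, y, P, hPmem, Q, hQmem, norm_le_of_mem_superdiff hPmem hUx hK, ?_, hxy.trans hdδ, ?_⟩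
  · have e : P - Q = (ψ' (x, y)).comp (ContinuousLinearMap.inl ℝ X X) +
        (ψ' (x, y)).comp (ContinuousLinearMap.inr ℝ X X) + g' y := by
      rw [hP, hQ, smul_neg]; abel
    have hc : ∀ J : X →L[ℝ] X × X, ‖J‖ ≤ 1 → ‖(ψ' (x, y)).comp J‖ ≤ ε := by
      intro J hJ
      refine ((ψ' (x, y)).opNorm_comp_le J).trans ?_
      have := mul_le_mul ((hψ'ε (x, y)).trans hε'ε) hJ (norm_nonneg _) hε.le
      linarith
    rw [e]
    have e1 := norm_add₃_le (a := (ψ' (x, y)).comp (ContinuousLinearMap.inl ℝ X X))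
      (b := (ψ' (x, y)).comp (ContinuousLinearMap.inr ℝ X X)) (c := g' y)
    linarith [hc _ (ContinuousLinearMap.norm_inl_le_one ℝ X X),
      hc _ (ContinuousLinearMap.norm_inr_le_one ℝ X X), hg'ε y]
  · linarith [(abs_le.1 (hgε x₀)).2, (abs_le.1 (hgε y)).1]

theorem CondA.neg {Y : Type*} [NormedAddCommGroup Y] {H : Y → ℝ → ℝ} (h : CondA H) : CondA (fun x t => -H x t) := by
  obtain ⟨C, ω, hC, hω, h0, h⟩ := h
  refine ⟨C, ω, hC, hω, h0, fun x₁ x₂ t₁ t₂ => ?_⟩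
  rw [neg_sub_neg, abs_sub_comm]
  exact h x₁ x₂ t₁ t₂

/-- At a strong minimum of a small smooth perturbation of `v - u`, near which `u` is Lipschitz,
the comparison inequality holds up to a small error. -/
theorem CondA.exists_sub_le [CompleteSpace X] (hb : HasUnitBump X) {H₁ H₂ : X → ℝ → ℝ}
    (hA : CondA H₁) {M : ℝ} (hM : ∀ x t, H₂ x t - H₁ x t ≤ M)
    {u v : X → ℝ} (husc : UpperSemicontinuous u) (hvlsc : LowerSemicontinuous v)
    {B : ℝ} (hu : ∀ x, |u x| ≤ B) (hv : ∀ x, |v x| ≤ B)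
    (husub : ∀ x : X, ∀ Δ ∈ superdiff u x, u x + H₁ x ‖Δ‖ ≤ 0)
    (hvsuper : ∀ x : X, ∀ Δ ∈ subdiff v x, 0 ≤ v x + H₂ x ‖Δ‖) {κ : ℝ} (hκ : 0 < κ) :
    ∃ ρ > 0, ∀ ε > 0, ε ≤ ρ → ∀ (g : X → ℝ) (g' : X → X →L[ℝ] ℝ) (x₀ : X),
      (∀ x, HasFDerivAt g (g' x) x) → (∀ x, |g x| ≤ ε) → (∀ x, ‖g' x‖ ≤ ε) →
      (∀ r > 0, ∃ η > 0, ∀ z, v z - u z + g z ≤ v x₀ - u x₀ + g x₀ + η → ‖z - x₀‖ ≤ r) →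
      (∃ U ∈ 𝓝 x₀, ∃ K : NNReal, LipschitzOnWith K u U) → u x₀ - v x₀ ≤ M + κ := by
  obtain ⟨C, ω, hC, hω, hω0, hA⟩ := hA
  have hlim : ∀ᶠ p in 𝓝 ((0 : ℝ), (0 : ℝ)), ω p.1 p.2 < κ / 4 := by
    refine hω.continuousAt.eventually (gt_mem_nhds ?_)
    simp only [hω0]
    positivity
  obtain ⟨s, hs, hsω⟩ := Metric.eventually_nhds_iff.1 hlim
  refine ⟨min (s / 6) (κ / 8), by positivity, ?_⟩
  rintro ε hε hερ g g' x₀ hg hgε hg'ε hstrong ⟨U, hU, K, hK⟩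
  have hεs : ε ≤ s / 6 := hερ.trans (min_le_left _ _)
  have hεκ : ε ≤ κ / 8 := hερ.trans (min_le_right _ _)
  set D := C * (K + 1 + 3 * ε) + 1 with hD
  have hD0 : 0 < D := by positivity
  obtain ⟨x, y, P, hP, Q, hQ, hPK, hPQ, hxy, hle⟩ := hb.exists_superdiff_subdiff husc hvlsc hu hv
    hg hε hgε hg'ε hstrong hU hK (δ := min (s / 2) (κ / (4 * D))) (by positivity)
  have e1 := husub x P hP
  have e2 := hvsuper y Q hQ
  have e3 := hM y ‖Q‖
  have e4 := (le_abs_self _).trans (hA y x ‖Q‖ ‖P‖)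
  have hn : |‖Q‖ - ‖P‖| ≤ 3 * ε := by
    rw [abs_sub_comm]
    exact (abs_norm_sub_norm_le P Q).trans hPQ
  have e5 : ω ‖y - x‖ (‖Q‖ - ‖P‖) < κ / 4 := by
    refine hsω (y := (‖y - x‖, ‖Q‖ - ‖P‖)) ?_
    rw [Prod.dist_eq, max_lt_iff, Real.dist_eq, Real.dist_eq, sub_zero, sub_zero, abs_norm]
    have := min_le_left (s / 2) (κ / (4 * D))
    rw [norm_sub_rev]
    constructor <;> linarith
  have e6 : C * max |‖Q‖| |‖P‖| * ‖y - x‖ ≤ κ / 4 := by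
    have h1 : max |‖Q‖| |‖P‖| ≤ K + 1 + 3 * ε := by
      rw [abs_norm, abs_norm]
      have := (abs_le.1 hn).2
      exact max_le (by linarith) (by linarith)
    have h2 : ‖y - x‖ ≤ κ / (4 * D) := by
      rw [norm_sub_rev]
      exact hxy.trans (min_le_right _ _)
    have h3 : C * max |‖Q‖| |‖P‖| ≤ D := by
      have := mul_le_mul_of_nonneg_left h1 hC
      linarith
    calc _ ≤ D * (κ / (4 * D)) := mul_le_mul h3 h2 (norm_nonneg _) hD0.le
      _ = κ / 4 := by field_simp
  linarith

theorem stmt13 [CompleteSpace X] (hbump : HasC1LipBump X)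
    (H₁ H₂ : X → ℝ → ℝ)
    (hH₁cont : Continuous (fun p : X × ℝ => H₁ p.1 p.2))
    (hH₂cont : Continuous (fun p : X × ℝ => H₂ p.1 p.2))
    (hH₁A : CondA H₁) (hH₂A : CondA H₂)
    (u v : X → ℝ)
    (husc : UpperSemicontinuous u) (hvlsc : LowerSemicontinuous v)
    (hubdd : ∃ C : ℝ, ∀ x, |u x| ≤ C) (hvbdd : ∃ C : ℝ, ∀ x, |v x| ≤ C)
    (husub : ∀ x : X, ∀ Δ ∈ superdiff u x, u x + H₁ x ‖Δ‖ ≤ 0)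
    (hvsuper : ∀ x : X, ∀ Δ ∈ subdiff v x, 0 ≤ v x + H₂ x ‖Δ‖)
    (hLip : ∀ x : X, (∃ U ∈ 𝓝 x, ∃ K : NNReal, LipschitzOnWith K u U) ∨
      (∃ U ∈ 𝓝 x, ∃ K : NNReal, LipschitzOnWith K v U)) :
    ∀ x : X, ((u x - v x : ℝ) : EReal) ≤
      ⨆ (y : X) (t : ℝ), ((H₂ y t - H₁ y t : ℝ) : EReal) := by
  have hb := hbump.hasUnitBump
  obtain ⟨Cu, hCu⟩ := hubdd
  obtain ⟨Cv, hCv⟩ := hvbdd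
  set B := max Cu Cv with hB
  have hu : ∀ x, |u x| ≤ B := fun x => (hCu x).trans (le_max_left _ _)
  have hv : ∀ x, |v x| ≤ B := fun x => (hCv x).trans (le_max_right _ _)
  intro x
  have hle : ∀ y t, ((H₂ y t - H₁ y t : ℝ) : EReal) ≤
      ⨆ (y : X) (t : ℝ), ((H₂ y t - H₁ y t : ℝ) : EReal) := fun y t =>
    le_iSup₂ (f := fun (y : X) (t : ℝ) => ((H₂ y t - H₁ y t : ℝ) : EReal)) y t
  generalize hσ : (⨆ (y : X) (t : ℝ), ((H₂ y t - H₁ y t : ℝ) : EReal)) = σ at hle ⊢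
  induction σ with
  | bot => exact absurd (le_bot_iff.1 (hle x 0)) (EReal.coe_ne_bot _)
  | top => exact le_top
  | coe M =>
    have hM : ∀ y t, H₂ y t - H₁ y t ≤ M := fun y t => EReal.coe_le_coe_iff.1 (hle y t)
    rw [EReal.coe_le_coe_iff]
    refine le_of_forall_pos_le_add fun κ hκ => ?_
    obtain ⟨ρ₁, hρ₁, h₁⟩ := hH₁A.exists_sub_le hb hM husc hvlsc hu hv husub hvsuper
      (half_pos hκ)
    obtain ⟨ρ₂, hρ₂, h₂⟩ := hH₂A.neg.exists_sub_le (H₂ := fun x t => -H₁ x t) (M := M)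
      (u := fun x => -v x) (v := fun x => -u x) hb
      (fun x t => by linarith [hM x t]) hvlsc.neg husc.neg (B := B)
      (fun x => by rw [abs_neg]; exact hv x) (fun x => by rw [abs_neg]; exact hu x)
      (fun x Δ hΔ => by
        have := hvsuper x (-Δ) (neg_mem_superdiff_neg.1 (by rwa [neg_neg]))
        rw [norm_neg] at this
        linarith)
      (fun x Δ hΔ => by
        have := neg_mem_superdiff_neg.2 hΔ
        simp only [neg_neg] at this
        have := husub x (-Δ) this
        rw [norm_neg] at this
        linarith) (half_pos hκ)
    set ε := min (min ρ₁ ρ₂) (κ / 4) with hε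
    have hε0 : 0 < ε := by positivity
    have hε1 : ε ≤ ρ₁ := (min_le_left _ _).trans (min_le_left _ _)
    have hε2 : ε ≤ ρ₂ := (min_le_left _ _).trans (min_le_right _ _)
    have hε3 : ε ≤ κ / 4 := min_le_right _ _
    obtain ⟨g, g', x₀, -, hg, hgε, hg'ε, hmin, hstrong⟩ := hb.exists_strong_min
      (fun z => v z + -u z) (hvlsc.add husc.neg) Set.univ isClosed_univ ⟨0, trivial⟩ (-(2 * B))
      (fun z _ => by linarith [(abs_le.1 (hu z)).2, (abs_le.1 (hv z)).1]) hε0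
    have hx : u x₀ - v x₀ ≤ M + κ / 2 := by
      rcases hLip x₀ with hL | ⟨U, hU, K, hK⟩
      · refine h₁ ε hε0 hε1 g g' x₀ hg hgε hg'ε (fun r hr => ?_) hL
        obtain ⟨η, hη, h⟩ := hstrong r hr
        exact ⟨η, hη, fun z hz => h z trivial (by linarith)⟩
      · have := h₂ ε hε0 hε2 g g' x₀ hg hgε hg'ε (fun r hr => ?_) ⟨U, hU, K, ?_⟩
        · linarith
        · obtain ⟨η, hη, h⟩ := hstrong r hr
          exact ⟨η, hη, fun z hz => h z trivial (by linarith)⟩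
        · exact hK.neg
    have := hmin x trivial
    linarith [(abs_le.1 (hgε x)).2, (abs_le.1 (hgε x₀)).1]
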